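/- Let n ≥ 1, let g : ℝⁿ → (symmetric positive-definite n×n real matrices) be smooth, let φ : ℝ → ℝ be smooth and positive, and let γ : ℝ × [0,t₀) → ℝ^{1+n} be a curve shortening flow in local coordinates with respect to the right warped product metric G_R. If at a point (x,t) the angle function Θ_R = ⟨T, ∂r⟩_{G_R} satisfies 0 < Θ_R ≤ 1, then at that point ∂_t Θ_R ≥ ΔΘ_R + (|A|²/2) Θ_R − 4((log φ)'(γ⁰))² − |(log φ)''(γ⁰)|, where γ⁰ denotes the 0-th component of γ(x,t). -/

import Mathlib

open scoped BigOperators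

noncomputable section

/-- Inner product of two vectors with respect to a metric matrix `G`. -/
def minner {m : ℕ} (G : Matrix (Fin m) (Fin m) ℝ) (u v : Fin m → ℝ) : ℝ :=
  ∑ α, ∑ β, u α * G α β * v β

/-- Norm of a vector with respect to a metric matrix `G`. -/
def mnorm {m : ℕ} (G : Matrix (Fin m) (Fin m) ℝ) (v : Fin m → ℝ) : ℝ :=
  Real.sqrt (minner G v v)

/-- Christoffel symbols `Γ^α_{βγ}` of the metric `G` at the point `p`:
`Γ^α_{βγ} = (1/2) Σ_δ (G⁻¹)^{αδ}(∂_β G_{δγ} + ∂_γ G_{δβ} − ∂_δ G_{βγ})`. -/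
def christoffel {m : ℕ} (G : (Fin m → ℝ) → Matrix (Fin m) (Fin m) ℝ)
    (p : Fin m → ℝ) (α β γ : Fin m) : ℝ :=
  (1 / 2) * ∑ δ, (G p)⁻¹ α δ *
      (fderiv ℝ (fun q => G q δ γ) p (Pi.single β 1)
        + fderiv ℝ (fun q => G q δ β) p (Pi.single γ 1)
        - fderiv ℝ (fun q => G q β γ) p (Pi.single δ 1))

/-- Unit tangent vector `T = ∂ₓc/|∂ₓc|_G` of a curve `c` with respect to the metric `G`. -/
def unitT {m : ℕ} (G : (Fin m → ℝ) → Matrix (Fin m) (Fin m) ℝ)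
    (c : ℝ → Fin m → ℝ) (x : ℝ) : Fin m → ℝ :=
  (mnorm (G (c x)) (deriv c x))⁻¹ • deriv c x

/-- Covariant derivative `∇_T V` of a vector field `V` along the curve `c`. -/
def covT {m : ℕ} (G : (Fin m → ℝ) → Matrix (Fin m) (Fin m) ℝ)
    (c V : ℝ → Fin m → ℝ) (x : ℝ) : Fin m → ℝ :=
  fun α => (mnorm (G (c x)) (deriv c x))⁻¹ *
    (deriv (fun y => V y α) x
      + ∑ β, ∑ δ, christoffel G (c x) α β δ * deriv c x β * V x δ)

/-- Mean curvature vector `H = ∇_T T` of the curve `c`. -/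
def meanCurv {m : ℕ} (G : (Fin m → ℝ) → Matrix (Fin m) (Fin m) ℝ)
    (c : ℝ → Fin m → ℝ) : ℝ → Fin m → ℝ :=
  covT G c (unitT G c)

/-- Directional derivative `T(η) = |∂ₓc|⁻¹ ∂ₓη` of a scalar function along the curve `c`. -/
def Tscal {m : ℕ} (G : (Fin m → ℝ) → Matrix (Fin m) (Fin m) ℝ)
    (c : ℝ → Fin m → ℝ) (η : ℝ → ℝ) (x : ℝ) : ℝ :=
  (mnorm (G (c x)) (deriv c x))⁻¹ * deriv η x

/-- Laplacian `Δη = T(T(η))` along the curve `c`. -/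
def lapScal {m : ℕ} (G : (Fin m → ℝ) → Matrix (Fin m) (Fin m) ℝ)
    (c : ℝ → Fin m → ℝ) (η : ℝ → ℝ) : ℝ → ℝ :=
  Tscal G c (Tscal G c η)

/-- Time covariant derivative `∇_t V` along a flow `γ`. -/
def covTime {m : ℕ} (G : (Fin m → ℝ) → Matrix (Fin m) (Fin m) ℝ)
    (γ V : ℝ → ℝ → Fin m → ℝ) (x t : ℝ) : Fin m → ℝ :=
  fun α => deriv (fun s => V x s α) t
    + ∑ β, ∑ δ, christoffel G (γ x t) α β δ * deriv (fun s => γ x s β) t * V x t δ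

/-- Left warped product metric `g + ψ²(x) dr²` on `ℝ^{1+n}` (index 0 is the circle direction). -/
def gwL {n : ℕ} (g : (Fin n → ℝ) → Matrix (Fin n) (Fin n) ℝ)
    (ψ : (Fin n → ℝ) → ℝ) (p : Fin (n + 1) → ℝ) : Matrix (Fin (n + 1)) (Fin (n + 1)) ℝ :=
  Matrix.of fun α β =>
    Fin.cases (Fin.cases ((ψ fun i => p i.succ) ^ 2) (fun _ => 0) β)
      (fun i => Fin.cases 0 (fun j => g (fun k => p k.succ) i j) β) α

/-- Right warped product metric `φ²(r) g + dr²` on `ℝ^{1+n}` (index 0 is the circle direction). -/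
def gwR {n : ℕ} (g : (Fin n → ℝ) → Matrix (Fin n) (Fin n) ℝ)
    (φ : ℝ → ℝ) (p : Fin (n + 1) → ℝ) : Matrix (Fin (n + 1)) (Fin (n + 1)) ℝ :=
  Matrix.of fun α β =>
    Fin.cases (Fin.cases 1 (fun _ => 0) β)
      (fun i => Fin.cases 0 (fun j => (φ (p 0)) ^ 2 * g (fun k => p k.succ) i j) β) α

/-- The vector `∂r = e₀` in `ℝ^{1+n}`. -/
def er (n : ℕ) : Fin (n + 1) → ℝ := Pi.single 0 1

/-- The gradient `D(log ψ)` of `log ψ` with respect to `(N, g)`, as a vector in `ℝ^{1+n}`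
with vanishing 0-th component. -/
def DlogPsi {n : ℕ} (g : (Fin n → ℝ) → Matrix (Fin n) (Fin n) ℝ)
    (ψ : (Fin n → ℝ) → ℝ) (x : Fin n → ℝ) : Fin (n + 1) → ℝ :=
  Fin.cases 0 (fun i => ∑ k, (g x)⁻¹ i k *
    fderiv ℝ (fun y => Real.log (ψ y)) x (Pi.single k 1))

/-- `|D(log ψ)|² = Σ_{k,l} (g⁻¹)^{kl} ∂_k(log ψ) ∂_l(log ψ)`. -/
def normSqDlogPsi {n : ℕ} (g : (Fin n → ℝ) → Matrix (Fin n) (Fin n) ℝ)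
    (ψ : (Fin n → ℝ) → ℝ) (x : Fin n → ℝ) : ℝ :=
  ∑ k, ∑ l, (g x)⁻¹ k l *
    fderiv ℝ (fun y => Real.log (ψ y)) x (Pi.single k 1) *
    fderiv ℝ (fun y => Real.log (ψ y)) x (Pi.single l 1)

/-- `∇_X ∂r` at the point `p`, i.e. `(∇_X ∂r)^α = Σ_β X^β Γ^α_{β0}`. -/
def covR {m : ℕ} [NeZero m] (G : (Fin m → ℝ) → Matrix (Fin m) (Fin m) ℝ)
    (p : Fin m → ℝ) (X : Fin m → ℝ) : Fin m → ℝ :=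
  fun α => ∑ β, X β * christoffel G p α β 0

/-- The angle function `Θ_L = ⟨T, ∂r⟩_{G_L}` of a flow `γ` in the left warped product. -/
def thetaL {n : ℕ} (g : (Fin n → ℝ) → Matrix (Fin n) (Fin n) ℝ)
    (ψ : (Fin n → ℝ) → ℝ) (γ : ℝ → ℝ → Fin (n + 1) → ℝ) (x t : ℝ) : ℝ :=
  minner (gwL g ψ (γ x t)) (unitT (gwL g ψ) (fun y => γ y t) x) (er n)

/-- The angle function `Θ_R = ⟨T, ∂r⟩_{G_R}` of a flow `γ` in the right warped product. -/
def thetaR {n : ℕ} (g : (Fin n → ℝ) → Matrix (Fin n) (Fin n) ℝ)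
    (φ : ℝ → ℝ) (γ : ℝ → ℝ → Fin (n + 1) → ℝ) (x t : ℝ) : ℝ :=
  minner (gwR g φ (γ x t)) (unitT (gwR g φ) (fun y => γ y t) x) (er n)

/-- The derivative of the metric `G` at `p` in the direction `u`, evaluated on `v` and `w`. -/
def metricDeriv {m : ℕ} (G : (Fin m → ℝ) → Matrix (Fin m) (Fin m) ℝ)
    (p u v w : Fin m → ℝ) : ℝ :=
  ∑ α, ∑ β, v α * fderiv ℝ (fun q => G q α β) p u * w β

section General

variable {m : ℕ}

theorem minner_eq_dotProduct (M : Matrix (Fin m) (Fin m) ℝ) (u v : Fin m → ℝ) :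
    minner M u v = u ⬝ᵥ M.mulVec v := by
  simp only [minner, dotProduct, Matrix.mulVec, Finset.mul_sum, mul_assoc]

theorem minner_add_right (M : Matrix (Fin m) (Fin m) ℝ) (u v w : Fin m → ℝ) :
    minner M u (v + w) = minner M u v + minner M u w := by
  simp only [minner_eq_dotProduct, Matrix.mulVec_add, dotProduct_add]

theorem minner_smul_right (M : Matrix (Fin m) (Fin m) ℝ) (a : ℝ) (u v : Fin m → ℝ) :
    minner M u (a • v) = a * minner M u v := by
  simp only [minner_eq_dotProduct, Matrix.mulVec_smul, dotProduct_smul, smul_eq_mul]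

theorem minner_comm {M : Matrix (Fin m) (Fin m) ℝ} (hM : M.IsSymm) (u v : Fin m → ℝ) :
    minner M u v = minner M v u := by
  unfold minner
  rw [Finset.sum_comm]
  refine Finset.sum_congr rfl fun β _ => Finset.sum_congr rfl fun α _ => ?_
  rw [← hM.apply β α]
  ring

theorem minner_self_pos {M : Matrix (Fin m) (Fin m) ℝ} (hM : M.PosDef) {v : Fin m → ℝ}
    (hv : v ≠ 0) : 0 < minner M v v := by
  rw [minner_eq_dotProduct]
  simpa using hM.dotProduct_mulVec_pos hv

theorem minner_self_nonneg {M : Matrix (Fin m) (Fin m) ℝ} (hM : M.PosDef) (v : Fin m → ℝ) :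
    0 ≤ minner M v v := by
  rw [minner_eq_dotProduct]
  simpa using hM.posSemidef.dotProduct_mulVec_nonneg v

theorem isSymm_of_posDef {M : Matrix (Fin m) (Fin m) ℝ} (hM : M.PosDef) : M.IsSymm := by
  have h := hM.isHermitian
  rwa [Matrix.IsHermitian, Matrix.conjTranspose_eq_transpose_of_trivial] at h

theorem mnorm_pos {M : Matrix (Fin m) (Fin m) ℝ} (hM : M.PosDef) {v : Fin m → ℝ}
    (hv : v ≠ 0) : 0 < mnorm M v :=
  Real.sqrt_pos.2 (minner_self_pos hM hv)

theorem mnorm_sq {M : Matrix (Fin m) (Fin m) ℝ} (hM : M.PosDef) (v : Fin m → ℝ) :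
    mnorm M v ^ 2 = minner M v v :=
  Real.sq_sqrt (minner_self_nonneg hM v)

variable {G : (Fin m → ℝ) → Matrix (Fin m) (Fin m) ℝ}

theorem metricDeriv_comm (hsymm : ∀ p, (G p).IsSymm) (p u v w : Fin m → ℝ) :
    metricDeriv G p u v w = metricDeriv G p u w v := by
  unfold metricDeriv
  rw [Finset.sum_comm]
  refine Finset.sum_congr rfl fun β _ => Finset.sum_congr rfl fun α _ => ?_
  have : (fun q => G q α β) = fun q => G q β α := funext fun q => (hsymm q).apply β α
  rw [this]
  ring

theorem fderiv_apply_eq_sum (f : (Fin m → ℝ) → ℝ) (p u : Fin m → ℝ) :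
    fderiv ℝ f p u = ∑ i, u i * fderiv ℝ f p (Pi.single i 1) := by
  conv_lhs => rw [pi_eq_sum_univ' u]
  simp [map_sum]

theorem hasDerivAt_minner (hG : ∀ α β, Differentiable ℝ fun q => G q α β)
    {c V W : ℝ → Fin m → ℝ} {c' V' W' : Fin m → ℝ} {x : ℝ}
    (hc : HasDerivAt c c' x) (hV : HasDerivAt V V' x) (hW : HasDerivAt W W' x) :
    HasDerivAt (fun y => minner (G (c y)) (V y) (W y))
      (metricDeriv G (c x) c' (V x) (W x) + minner (G (c x)) V' (W x)
        + minner (G (c x)) (V x) W') x := by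
  have h := HasDerivAt.fun_sum (u := Finset.univ) fun α _ =>
    HasDerivAt.fun_sum (u := Finset.univ) fun β _ =>
      (((hasDerivAt_pi.1 hV α).mul ((hG α β (c x)).hasFDerivAt.comp_hasDerivAt x hc)).mul
        (hasDerivAt_pi.1 hW β))
  refine h.congr_deriv ?_
  simp only [metricDeriv, minner, ← Finset.sum_add_distrib, Function.comp_apply, Pi.mul_apply]
  refine Finset.sum_congr rfl fun α _ => Finset.sum_congr rfl fun β _ => ?_
  ring

theorem hasDerivAt_mnorm (hG : ∀ α β, Differentiable ℝ fun q => G q α β)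
    (hpd : ∀ p, (G p).PosDef) {c V : ℝ → Fin m → ℝ} {c' V' : Fin m → ℝ} {x : ℝ}
    (hc : HasDerivAt c c' x) (hV : HasDerivAt V V' x) (hV0 : V x ≠ 0) :
    HasDerivAt (fun y => mnorm (G (c y)) (V y))
      ((metricDeriv G (c x) c' (V x) (V x) + 2 * minner (G (c x)) (V x) V')
        / (2 * mnorm (G (c x)) (V x))) x := by
  have h := (hasDerivAt_minner hG hc hV hV).sqrt (minner_self_pos (hpd _) hV0).ne'
  refine h.congr_deriv ?_
  rw [minner_comm (isSymm_of_posDef (hpd _)) V' (V x), mnorm]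
  ring

/-- Lowering the index of the Christoffel symbols contracted twice with the same vector. -/
theorem minner_christoffel (hpd : ∀ p, (G p).PosDef) (p w u : Fin m → ℝ) :
    minner (G p) w (fun α => ∑ β, ∑ δ, christoffel G p α β δ * u β * u δ)
      = metricDeriv G p u w u - metricDeriv G p w u u / 2 := by
  have hsymm := fun p => isSymm_of_posDef (hpd p)
  set S : Fin m → ℝ := fun κ => ∑ β, ∑ δ,
    (fderiv ℝ (fun q => G q κ δ) p (Pi.single β 1)
        + fderiv ℝ (fun q => G q κ β) p (Pi.single δ 1)
        - fderiv ℝ (fun q => G q β δ) p (Pi.single κ 1)) * u β * u δ with hS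
  have hΓ : (fun α => ∑ β, ∑ δ, christoffel G p α β δ * u β * u δ)
      = (1 / 2 : ℝ) • (G p)⁻¹.mulVec S := by
    ext α
    simp only [christoffel, Pi.smul_apply, Matrix.mulVec, dotProduct, hS, smul_eq_mul,
      Finset.mul_sum, Finset.sum_mul]
    rw [Finset.sum_comm_cycle]
    refine Finset.sum_congr rfl fun κ _ => Finset.sum_congr rfl fun β _ =>
      Finset.sum_congr rfl fun δ _ => ?_
    ring
  have hunit : IsUnit (G p).det := (hpd p).det_pos.ne'.isUnit
  rw [hΓ, minner_smul_right, minner_eq_dotProduct, Matrix.mulVec_mulVec,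
    Matrix.mul_nonsing_inv _ hunit, Matrix.one_mulVec]
  have h1 : metricDeriv G p u w u = ∑ κ, ∑ β, ∑ δ,
      w κ * (fderiv ℝ (fun q => G q κ δ) p (Pi.single β 1) * u β * u δ) := by
    unfold metricDeriv
    refine Finset.sum_congr rfl fun κ _ => ?_
    rw [Finset.sum_comm]
    refine Finset.sum_congr rfl fun δ _ => ?_
    rw [fderiv_apply_eq_sum _ p u, Finset.mul_sum, Finset.sum_mul]
    exact Finset.sum_congr rfl fun β _ => by ring
  have h2 : metricDeriv G p u w u = ∑ κ, ∑ β, ∑ δ,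
      w κ * (fderiv ℝ (fun q => G q κ β) p (Pi.single δ 1) * u β * u δ) := by
    unfold metricDeriv
    refine Finset.sum_congr rfl fun κ _ => Finset.sum_congr rfl fun β _ => ?_
    rw [fderiv_apply_eq_sum _ p u, Finset.mul_sum, Finset.sum_mul]
    exact Finset.sum_congr rfl fun δ _ => by ring
  have h3 : metricDeriv G p w u u = ∑ κ, ∑ β, ∑ δ,
      w κ * (fderiv ℝ (fun q => G q β δ) p (Pi.single κ 1) * u β * u δ) := by
    unfold metricDeriv
    rw [← Finset.sum_comm_cycle]
    refine Finset.sum_congr rfl fun β _ => ?_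
    refine Finset.sum_congr rfl fun δ _ => ?_
    rw [fderiv_apply_eq_sum _ p w, Finset.mul_sum, Finset.sum_mul]
    exact Finset.sum_congr rfl fun κ _ => by ring
  have h4 : w ⬝ᵥ S = metricDeriv G p u w u + metricDeriv G p u w u - metricDeriv G p w u u := by
    nth_rewrite 1 [h1]
    rw [h2, h3]
    simp only [dotProduct, hS, Finset.mul_sum, ← Finset.sum_add_distrib,
      ← Finset.sum_sub_distrib]
    refine Finset.sum_congr rfl fun κ _ => Finset.sum_congr rfl fun β _ =>
      Finset.sum_congr rfl fun δ _ => ?_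
    ring
  rw [h4]
  ring

/-- The mean curvature vector paired with an arbitrary vector `w`. -/
theorem minner_meanCurv (hpd : ∀ p, (G p).PosDef) {c : ℝ → Fin m → ℝ} {c'' : Fin m → ℝ} {x v' : ℝ}
    (hc'' : HasDerivAt (deriv c) c'' x) (hreg : deriv c x ≠ 0)
    (hv : HasDerivAt (fun y => mnorm (G (c y)) (deriv c y)) v' x) (w : Fin m → ℝ) :
    mnorm (G (c x)) (deriv c x) ^ 2 * minner (G (c x)) w (meanCurv G c x)
      = minner (G (c x)) w c''
        - v' / mnorm (G (c x)) (deriv c x) * minner (G (c x)) w (deriv c x)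
        + metricDeriv G (c x) (deriv c x) w (deriv c x)
        - metricDeriv G (c x) w (deriv c x) (deriv c x) / 2 := by
  have hpos : 0 < mnorm (G (c x)) (deriv c x) := mnorm_pos (hpd _) hreg
  have hT : HasDerivAt (unitT G c) _ x := (hv.fun_inv hpos.ne').smul hc''
  set v := mnorm (G (c x)) (deriv c x) with hvdef
  have hH : meanCurv G c x = v⁻¹ ^ 2 • (c'' + (-(v' / v)) • deriv c x
      + fun α => ∑ β, ∑ δ, christoffel G (c x) α β δ * deriv c x β * deriv c x δ) := by
    ext α
    have hd := (hasDerivAt_pi.1 hT α).deriv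
    simp only [meanCurv, covT]
    rw [hd]
    have hs : ∑ β, ∑ δ, christoffel G (c x) α β δ * deriv c x β * unitT G c x δ
        = v⁻¹ * ∑ β, ∑ δ, christoffel G (c x) α β δ * deriv c x β * deriv c x δ := by
      simp only [unitT, Pi.smul_apply, smul_eq_mul, Finset.mul_sum, ← hvdef]
      exact Finset.sum_congr rfl fun β _ => Finset.sum_congr rfl fun δ _ => by ring
    rw [hs]
    simp only [Pi.add_apply, Pi.smul_apply, smul_eq_mul, ← hvdef]
    field_simp
  rw [hH, minner_smul_right, minner_add_right, minner_add_right, minner_smul_right,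
    minner_christoffel hpd]
  field_simp
  ring

theorem minner_velocity_meanCurv (hG : ∀ α β, Differentiable ℝ fun q => G q α β)
    (hpd : ∀ p, (G p).PosDef) {c : ℝ → Fin m → ℝ} {x : ℝ} (hc : DifferentiableAt ℝ c x)
    (hc' : DifferentiableAt ℝ (deriv c) x) (hreg : deriv c x ≠ 0) :
    minner (G (c x)) (deriv c x) (meanCurv G c x) = 0 := by
  have hv := hasDerivAt_mnorm hG hpd hc.hasDerivAt hc'.hasDerivAt hreg
  have hpos : 0 < mnorm (G (c x)) (deriv c x) := mnorm_pos (hpd _) hreg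
  have h := minner_meanCurv hpd hc'.hasDerivAt hreg hv (deriv c x)
  rw [← mnorm_sq (hpd (c x)) (deriv c x)] at h
  refine (mul_eq_zero.1 (h.trans ?_)).resolve_left (pow_ne_zero 2 hpos.ne')
  field_simp
  ring

/-- Under a variation of the curve `c` whose velocity field `H` coincides with the mean
curvature vector, the speed decreases at the relative rate `|H|²`. -/
theorem hasDerivAt_mnorm_flow (hG : ∀ α β, Differentiable ℝ fun q => G q α β)
    (hpd : ∀ p, (G p).PosDef) {c b U : ℝ → Fin m → ℝ} {H' : Fin m → ℝ} {x t : ℝ}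
    (hc : Differentiable ℝ c) (hc' : Differentiable ℝ (deriv c)) (hreg : ∀ y, deriv c y ≠ 0)
    (hH' : HasDerivAt (meanCurv G c) H' x) (hbt : b t = c x) (hUt : U t = deriv c x)
    (hb : HasDerivAt b (meanCurv G c x) t) (hU : HasDerivAt U H' t) :
    HasDerivAt (fun s => mnorm (G (b s)) (U s))
      (-(minner (G (c x)) (meanCurv G c x) (meanCurv G c x) * mnorm (G (c x)) (deriv c x))) t := by
  have hsymm := fun p => isSymm_of_posDef (hpd p)
  have h := hasDerivAt_mnorm hG hpd hb hU (hUt ▸ hreg x)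
  rw [hbt, hUt] at h
  refine h.congr_deriv ?_
  have hpos : 0 < mnorm (G (c x)) (deriv c x) := mnorm_pos (hpd _) (hreg x)
  have hv := hasDerivAt_mnorm hG hpd (hc x).hasDerivAt (hc' x).hasDerivAt (hreg x)
  have horth : (fun y => minner (G (c y)) (deriv c y) (meanCurv G c y)) = fun _ => 0 :=
    funext fun y => minner_velocity_meanCurv hG hpd (hc y) (hc' y) (hreg y)
  have h0 := (hasDerivAt_minner hG (hc x).hasDerivAt (hc' x).hasDerivAt hH').deriv
  rw [horth, deriv_const] at h0
  have hHH := minner_meanCurv hpd (hc' x).hasDerivAt (hreg x) hv (meanCurv G c x)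
  rw [minner_comm (hsymm _) (meanCurv G c x) (deriv c x),
    minner_velocity_meanCurv hG hpd (hc x) (hc' x) (hreg x), mul_zero] at hHH
  rw [minner_comm (hsymm _) _ (meanCurv G c x), metricDeriv_comm hsymm _ _ (deriv c x)] at h0
  field_simp
  linarith

end General

section WarpedProduct

variable {n : ℕ} {g : (Fin n → ℝ) → Matrix (Fin n) (Fin n) ℝ} {φ : ℝ → ℝ}

theorem minner_gwR (p u v : Fin (n + 1) → ℝ) :
    minner (gwR g φ p) u v = u 0 * v 0
      + φ (p 0) ^ 2 * minner (g fun k => p k.succ) (fun i => u i.succ) fun i => v i.succ := by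
  simp only [minner, gwR, Fin.sum_univ_succ, Matrix.of_apply, Fin.cases_zero, Fin.cases_succ,
    Finset.mul_sum, mul_one, mul_zero, zero_mul, Finset.sum_const_zero, add_zero, zero_add]
  congr 1
  exact Finset.sum_congr rfl fun i _ => Finset.sum_congr rfl fun j _ => by ring

theorem minner_gwR_er_left (p v : Fin (n + 1) → ℝ) :
    minner (gwR g φ p) (er n) v = v 0 := by
  rw [minner_gwR]
  simp [er, minner]

theorem minner_gwR_er_right (p v : Fin (n + 1) → ℝ) :
    minner (gwR g φ p) v (er n) = v 0 := by
  rw [minner_gwR]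
  simp [er, minner]

theorem posDef_gwR (hgpd : ∀ x, (g x).PosDef) (hφpos : ∀ r, 0 < φ r) (p : Fin (n + 1) → ℝ) :
    (gwR g φ p).PosDef := by
  refine .of_dotProduct_mulVec_pos ?_ fun v hv => ?_
  · rw [Matrix.IsHermitian, Matrix.conjTranspose_eq_transpose_of_trivial]
    ext α β
    refine Fin.cases ?_ (fun i => ?_) α <;> refine Fin.cases ?_ (fun j => ?_) β <;>
      simp [gwR, Matrix.transpose_apply]
    exact Or.inl ((isSymm_of_posDef (hgpd _)).apply i j)
  · rw [star_trivial, ← minner_eq_dotProduct, minner_gwR]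
    have hnn := minner_self_nonneg (hgpd fun k => p k.succ) fun i => v i.succ
    by_cases h : (fun i : Fin n => v i.succ) = 0
    · have h0 : v 0 ≠ 0 := fun h0 => hv <| funext fun α =>
        Fin.cases h0 (fun i => congrFun h i) α
      have := mul_self_pos.2 h0
      have := hφpos (p 0)
      positivity
    · have := minner_self_pos (hgpd fun k => p k.succ) h
      have := hφpos (p 0)
      have := mul_self_nonneg (v 0)
      positivity

theorem differentiable_gwR (hg : ∀ i j, Differentiable ℝ fun x => g x i j)
    (hφ : Differentiable ℝ φ) (α β : Fin (n + 1)) :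
    Differentiable ℝ fun q => gwR g φ q α β := by
  refine Fin.cases ?_ (fun i => ?_) α <;> refine Fin.cases ?_ (fun j => ?_) β <;>
    simp only [gwR, Matrix.of_apply, Fin.cases_zero, Fin.cases_succ, differentiable_const]
  have h1 : Differentiable ℝ fun q : Fin (n + 1) → ℝ => φ (q 0) := by fun_prop
  have h2 : Differentiable ℝ fun q : Fin (n + 1) → ℝ => g (fun k => q k.succ) i j :=
    (hg i j).comp (f := fun (q : Fin (n + 1) → ℝ) (k : Fin n) => q k.succ) (by fun_prop)
  exact (h1.pow 2).mul h2

theorem fderiv_gwR_er (hg : ∀ i j, Differentiable ℝ fun x => g x i j)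
    (hφ : Differentiable ℝ φ) (p : Fin (n + 1) → ℝ) (i j : Fin n) :
    fderiv ℝ (fun q => gwR g φ q i.succ j.succ) p (er n)
      = 2 * φ (p 0) * deriv φ (p 0) * g (fun k => p k.succ) i j := by
  have hd : HasFDerivAt (fun q => gwR g φ q i.succ j.succ) _
      (Function.update p 0 (p 0)) := (differentiable_gwR hg hφ i.succ j.succ _).hasFDerivAt
  have h := hd.comp_hasDerivAt (p 0) (hasDerivAt_update p 0 (p 0))
  rw [Function.update_eq_self] at h
  refine h.unique ?_
  have h' := ((hφ (p 0)).hasDerivAt.fun_pow 2).mul_const (g (fun k => p k.succ) i j)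
  refine (h'.congr_deriv (by simp)).congr_of_eventuallyEq (.of_forall fun s => ?_)
  simp [gwR]

theorem metricDeriv_gwR_er_middle (p u w : Fin (n + 1) → ℝ) :
    metricDeriv (gwR g φ) p u (er n) w = 0 := by
  simp [metricDeriv, er, Fin.sum_univ_succ, gwR]

theorem metricDeriv_gwR_er_left (hg : ∀ i j, Differentiable ℝ fun x => g x i j)
    (hφ : Differentiable ℝ φ) (hφpos : ∀ r, 0 < φ r) (p w : Fin (n + 1) → ℝ) :
    metricDeriv (gwR g φ) p (er n) w w
      = 2 * (deriv φ (p 0) / φ (p 0)) * (minner (gwR g φ p) w w - w 0 ^ 2) := by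
  have h00 : (fun q => gwR g φ q 0 0) = fun _ => 1 := by ext q; simp [gwR]
  have h0 : ∀ j : Fin n, (fun q => gwR g φ q 0 j.succ) = fun _ => 0 := fun j => by
    ext q; simp [gwR]
  have h1 : ∀ j : Fin n, (fun q => gwR g φ q j.succ 0) = fun _ => 0 := fun j => by
    ext q; simp [gwR]
  have hne := (hφpos (p 0)).ne'
  rw [minner_gwR]
  simp only [metricDeriv, Fin.sum_univ_succ, h00, h0, h1, fderiv_gwR_er hg hφ, minner]
  have hs : (∑ i : Fin n, ∑ j : Fin n, w i.succ
      * (2 * φ (p 0) * deriv φ (p 0) * g (fun k => p k.succ) i j) * w j.succ)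
      = 2 * φ (p 0) * deriv φ (p 0)
        * ∑ i : Fin n, ∑ j : Fin n, w i.succ * g (fun k => p k.succ) i j * w j.succ := by
    simp only [Finset.mul_sum]
    exact Finset.sum_congr rfl fun i _ => Finset.sum_congr rfl fun j _ => by ring
  simp [hs]
  field_simp
  ring

theorem sq_zero_le_minner_gwR (hgpd : ∀ x, (g x).PosDef) (p v : Fin (n + 1) → ℝ) :
    v 0 ^ 2 ≤ minner (gwR g φ p) v v := by
  rw [minner_gwR]
  have := minner_self_nonneg (hgpd fun k => p k.succ) fun i => v i.succ
  nlinarith [mul_nonneg (sq_nonneg (φ (p 0))) this]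

theorem unitT_gwR_er (c : ℝ → Fin (n + 1) → ℝ) (x : ℝ) :
    minner (gwR g φ (c x)) (unitT (gwR g φ) c x) (er n)
      = (mnorm (gwR g φ (c x)) (deriv c x))⁻¹ * deriv c x 0 := by
  rw [minner_gwR_er_right, unitT, Pi.smul_apply, smul_eq_mul]

theorem hasDerivAt_angle
    (hg : ∀ i j, Differentiable ℝ fun x => g x i j) (hgpd : ∀ x, (g x).PosDef)
    (hφ : Differentiable ℝ φ) (hφpos : ∀ r, 0 < φ r) {c : ℝ → Fin (n + 1) → ℝ} {x : ℝ}
    (hc : DifferentiableAt ℝ c x) (hc' : DifferentiableAt ℝ (deriv c) x) (hreg : deriv c x ≠ 0) :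
    HasDerivAt (fun y => minner (gwR g φ (c y)) (unitT (gwR g φ) c y) (er n))
      (mnorm (gwR g φ (c x)) (deriv c x) * (meanCurv (gwR g φ) c x 0
        + deriv φ (c x 0) / φ (c x 0)
          * (1 - minner (gwR g φ (c x)) (unitT (gwR g φ) c x) (er n) ^ 2))) x := by
  have hpd := posDef_gwR hgpd hφpos
  have hpos : 0 < mnorm (gwR g φ (c x)) (deriv c x) := mnorm_pos (hpd _) hreg
  have hv := hasDerivAt_mnorm (differentiable_gwR hg hφ) hpd hc.hasDerivAt hc'.hasDerivAt hreg
  have h := minner_meanCurv hpd hc'.hasDerivAt hreg hv (er n)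
  rw [metricDeriv_gwR_er_middle, metricDeriv_gwR_er_left hg hφ hφpos,
    ← mnorm_sq (hpd (c x)) (deriv c x)] at h
  simp only [minner_gwR_er_left] at h
  simp only [unitT_gwR_er]
  refine ((hv.fun_inv hpos.ne').mul (hasDerivAt_pi.1 hc'.hasDerivAt 0)).congr_deriv ?_
  set v := mnorm (gwR g φ (c x)) (deriv c x)
  set v' := (metricDeriv (gwR g φ) (c x) (deriv c x) (deriv c x) (deriv c x)
    + 2 * minner (gwR g φ (c x)) (deriv c x) (deriv (deriv c) x)) / (2 * v)
  have hH : meanCurv (gwR g φ) c x 0 = (v ^ 2)⁻¹ * (v ^ 2 * meanCurv (gwR g φ) c x 0) := by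
    field_simp
  rw [hH, h]
  have := (hφpos (c x 0)).ne'
  clear_value v v'
  field_simp
  ring

theorem Tscal_angle
    (hg : ∀ i j, Differentiable ℝ fun x => g x i j) (hgpd : ∀ x, (g x).PosDef)
    (hφ : Differentiable ℝ φ) (hφpos : ∀ r, 0 < φ r) {c : ℝ → Fin (n + 1) → ℝ} {x : ℝ}
    (hc : DifferentiableAt ℝ c x) (hc' : DifferentiableAt ℝ (deriv c) x) (hreg : deriv c x ≠ 0) :
    Tscal (gwR g φ) c (fun y => minner (gwR g φ (c y)) (unitT (gwR g φ) c y) (er n)) x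
      = meanCurv (gwR g φ) c x 0 + deriv φ (c x 0) / φ (c x 0)
          * (1 - minner (gwR g φ (c x)) (unitT (gwR g φ) c x) (er n) ^ 2) := by
  have hpos : 0 < mnorm (gwR g φ (c x)) (deriv c x) :=
    mnorm_pos (posDef_gwR hgpd hφpos _) hreg
  rw [Tscal, (hasDerivAt_angle hg hgpd hφ hφpos hc hc' hreg).deriv,
    inv_mul_cancel_left₀ hpos.ne']

end WarpedProduct

/-- Symmetry of the mixed second derivatives of a two-parameter map. -/
theorem hasDerivAt_deriv_comm {E : Type*} [NormedAddCommGroup E] [NormedSpace ℝ E]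
    {γ : ℝ → ℝ → E} (hγ : ContDiff ℝ 2 fun q : ℝ × ℝ => γ q.1 q.2) (x t : ℝ) :
    ∃ W, HasDerivAt (fun y => deriv (γ y) t) W x ∧
      HasDerivAt (fun s => deriv (fun y => γ y s) x) W t := by
  set F : ℝ × ℝ → E := fun q => γ q.1 q.2
  have hd : Differentiable ℝ F := hγ.differentiable (by norm_num)
  have hd2 : Differentiable ℝ (fderiv ℝ F) :=
    (hγ.fderiv_right (m := 1) (by norm_num)).differentiable (by norm_num)
  have hline1 (y s : ℝ) : HasDerivAt (fun z : ℝ => (z, s)) ((1 : ℝ), (0 : ℝ)) y :=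
    (hasDerivAt_id y).prodMk (hasDerivAt_const y s)
  have hline2 (y s : ℝ) : HasDerivAt (fun z : ℝ => (y, z)) ((0 : ℝ), (1 : ℝ)) s :=
    (hasDerivAt_const s y).prodMk (hasDerivAt_id s)
  have h1 (y s : ℝ) : deriv (fun z => γ z s) y = fderiv ℝ F (y, s) (1, 0) :=
    (HasFDerivAt.comp_hasDerivAt (l := F) y (hd (y, s)).hasFDerivAt (hline1 y s)).deriv
  have h2 (y s : ℝ) : deriv (γ y) s = fderiv ℝ F (y, s) (0, 1) :=
    (HasFDerivAt.comp_hasDerivAt (l := F) s (hd (y, s)).hasFDerivAt (hline2 y s)).deriv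
  have hsymm : IsSymmSndFDerivAt ℝ F (x, t) :=
    hγ.contDiffAt.isSymmSndFDerivAt (by simp)
  refine ⟨fderiv ℝ (fderiv ℝ F) (x, t) (1, 0) (0, 1), ?_, ?_⟩
  · simp only [h2]
    have h : HasDerivAt (fun y => fderiv ℝ F (y, t)) _ x :=
      (hd2 (x, t)).hasFDerivAt.comp_hasDerivAt x (hline1 x t)
    simpa using h.clm_apply (hasDerivAt_const x (0, 1))
  · rw [hsymm.eq]
    simp only [h1]
    have h : HasDerivAt (fun s => fderiv ℝ F (x, s)) _ t :=
      (hd2 (x, t)).hasFDerivAt.comp_hasDerivAt t (hline2 x t)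
    simpa using h.clm_apply (hasDerivAt_const t (1, 0))

theorem deriv_log_comp_eq {φ : ℝ → ℝ} (hφ : Differentiable ℝ φ) (hφpos : ∀ r, 0 < φ r) :
    deriv (fun s => Real.log (φ s)) = fun s => deriv φ s / φ s :=
  funext fun s => ((hφ s).hasDerivAt.log (hφpos s).ne').deriv

/-- The algebraic estimate behind the evolution inequality for the angle function. -/
theorem angle_reaction_nonneg {Θ A H₀ ρ ρ' : ℝ} (h0 : 0 < Θ) (h1 : Θ ≤ 1) (hA : H₀ ^ 2 ≤ A) :
    0 ≤ A / 2 * Θ + 2 * ρ * Θ * (H₀ + ρ * (1 - Θ ^ 2)) - ρ' * Θ * (1 - Θ ^ 2)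
      + 4 * ρ ^ 2 + |ρ'| := by
  have hs : 0 ≤ 1 - Θ ^ 2 := by nlinarith
  have hs1 : Θ * (1 - Θ ^ 2) ≤ 1 := by nlinarith
  have e1 : ρ' * Θ * (1 - Θ ^ 2) ≤ |ρ'| := by
    have := mul_le_mul_of_nonneg_right (le_abs_self ρ') (mul_nonneg h0.le hs)
    nlinarith [mul_le_mul_of_nonneg_left hs1 (abs_nonneg ρ')]
  have e2 : 0 ≤ Θ * (A / 2 + 2 * ρ * H₀ + 2 * ρ ^ 2) :=
    mul_nonneg h0.le (by nlinarith [sq_nonneg (H₀ + 2 * ρ)])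
  have e3 : 0 ≤ 2 * ρ ^ 2 * (Θ * (1 - Θ ^ 2)) := by positivity
  have e4 : ρ ^ 2 * Θ ≤ ρ ^ 2 := mul_le_of_le_one_right (sq_nonneg ρ) h1
  nlinarith [sq_nonneg ρ]

/-- If `0 < Θ_R ≤ 1` at a point, then
`∂_t Θ_R ≥ ΔΘ_R + (|A|²/2)Θ_R − 4((log φ)'(γ⁰))² − |(log φ)''(γ⁰)|`. -/
theorem stmt13 {n : ℕ} (hn : 1 ≤ n)
    (g : (Fin n → ℝ) → Matrix (Fin n) (Fin n) ℝ)
    (hg : ∀ i j, ContDiff ℝ (⊤ : ℕ∞) fun x => g x i j)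
    (hgpd : ∀ x, (g x).PosDef)
    (φ : ℝ → ℝ) (hφ : ContDiff ℝ (⊤ : ℕ∞) φ) (hφpos : ∀ r, 0 < φ r)
    (t₀ : ℝ) (γ : ℝ → ℝ → Fin (n + 1) → ℝ)
    (hγ : ContDiff ℝ (⊤ : ℕ∞) fun q : ℝ × ℝ => γ q.1 q.2)
    (hreg : ∀ x t, deriv (fun y => γ y t) x ≠ 0)
    (hflow : ∀ x : ℝ, ∀ t ∈ Set.Ico (0 : ℝ) t₀,
      deriv (γ x) t = meanCurv (gwR g φ) (fun y => γ y t) x)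
    (x : ℝ) (t : ℝ) (ht : t ∈ Set.Ico (0 : ℝ) t₀)
    (hΘ0 : 0 < thetaR g φ γ x t) (hΘ1 : thetaR g φ γ x t ≤ 1) :
    deriv (fun s => thetaR g φ γ x s) t
      ≥ lapScal (gwR g φ) (fun y => γ y t) (fun y => thetaR g φ γ y t) x
        + (minner (gwR g φ (γ x t)) (meanCurv (gwR g φ) (fun y => γ y t) x)
            (meanCurv (gwR g φ) (fun y => γ y t) x) / 2) * thetaR g φ γ x t
        - 4 * (deriv (fun s => Real.log (φ s)) (γ x t 0)) ^ 2
        - |deriv (deriv fun s => Real.log (φ s)) (γ x t 0)| := by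
  have hg1 := fun i j => (hg i j).differentiable (by simp)
  have hφ1 : Differentiable ℝ φ := hφ.differentiable (by simp)
  have hφ2 : Differentiable ℝ (deriv φ) :=
    (contDiff_infty_iff_deriv.1 hφ).2.differentiable (by simp)
  have hpd := posDef_gwR hgpd hφpos
  have hG := differentiable_gwR hg1 hφ1
  have hγ2 : ContDiff ℝ 2 fun q : ℝ × ℝ => γ q.1 q.2 := contDiff_infty.1 hγ 2
  obtain ⟨H', hH', hU⟩ := hasDerivAt_deriv_comm hγ2 x t
  have hflow_slice : (fun y => deriv (γ y) t) = meanCurv (gwR g φ) fun y => γ y t :=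
    funext fun y => hflow y t ht
  rw [hflow_slice] at hH'
  have hb : HasDerivAt (γ x) (meanCurv (gwR g φ) (fun y => γ y t) x) t := by
    rw [← hflow x t ht]
    exact ((hγ.comp (contDiff_prodMk_right x)).differentiable (by simp) t).hasDerivAt
  have hcs : ContDiff ℝ (⊤ : ℕ∞) fun y => γ y t := hγ.comp (contDiff_prodMk_left t)
  have hc := hcs.differentiable (by simp)
  have hc' := (contDiff_infty_iff_deriv.1 hcs).2.differentiable (by simp)
  have hpos : 0 < mnorm (gwR g φ (γ x t)) (deriv (fun y => γ y t) x) :=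
    mnorm_pos (hpd _) (hreg x t)
  have hvt := hasDerivAt_mnorm_flow hG hpd hc hc' (fun y => hreg y t) hH' rfl rfl hb hU
  have hΘt : HasDerivAt (fun s => thetaR g φ γ x s) _ t :=
    ((hvt.fun_inv hpos.ne').mul (hasDerivAt_pi.1 hU 0)).congr_of_eventuallyEq
      (.of_forall fun s => unitT_gwR_er (fun y => γ y s) x)
  have hρ : HasDerivAt (fun s => deriv φ s / φ s)
      (deriv (fun s => deriv φ s / φ s) (γ x t 0)) (γ x t 0) :=
    ((hφ2 _).div (hφ1 _) (hφpos _).ne').hasDerivAt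
  have hρc : HasDerivAt (fun y => deriv φ (γ y t 0) / φ (γ y t 0)) _ x :=
    HasDerivAt.comp (h₂ := fun s => deriv φ s / φ s) x hρ (hasDerivAt_pi.1 (hc x).hasDerivAt 0)
  have hΘx : HasDerivAt (fun y => thetaR g φ γ y t)
      (mnorm (gwR g φ (γ x t)) (deriv (fun y => γ y t) x)
        * (meanCurv (gwR g φ) (fun y => γ y t) x 0
          + deriv φ (γ x t 0) / φ (γ x t 0) * (1 - thetaR g φ γ x t ^ 2))) x :=
    hasDerivAt_angle hg1 hgpd hφ1 hφpos (hc x) (hc' x) (hreg x t)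
  have hTΘ : Tscal (gwR g φ) (fun y => γ y t) (fun y => thetaR g φ γ y t)
      = fun y => meanCurv (gwR g φ) (fun y => γ y t) y 0
        + deriv φ (γ y t 0) / φ (γ y t 0) * (1 - thetaR g φ γ y t ^ 2) :=
    funext fun y => Tscal_angle hg1 hgpd hφ1 hφpos (hc y) (hc' y) (hreg y t)
  have hlap : HasDerivAt (fun y => meanCurv (gwR g φ) (fun y => γ y t) y 0
      + deriv φ (γ y t 0) / φ (γ y t 0) * (1 - thetaR g φ γ y t ^ 2)) _ x :=
    (hasDerivAt_pi.1 hH' 0).add (hρc.mul ((hΘx.fun_pow 2).const_sub 1))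
  have hT0 : deriv (fun y => γ y t) x 0
      = mnorm (gwR g φ (γ x t)) (deriv (fun y => γ y t) x) * thetaR g φ γ x t := by
    rw [thetaR, unitT_gwR_er (fun y => γ y t) x, mul_inv_cancel_left₀ hpos.ne']
  have hreact := angle_reaction_nonneg (ρ := deriv φ (γ x t 0) / φ (γ x t 0))
    (ρ' := deriv (fun s => deriv φ s / φ s) (γ x t 0)) hΘ0 hΘ1
    (sq_zero_le_minner_gwR (φ := φ) hgpd (γ x t) (meanCurv (gwR g φ) (fun y => γ y t) x))
  rw [hΘt.deriv, deriv_log_comp_eq hφ1 hφpos, lapScal, hTΘ, Tscal, hlap.deriv, hT0]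
  beta_reduce
  generalize mnorm (gwR g φ (γ x t)) (deriv (fun y => γ y t) x) = v at *
  generalize deriv φ (γ x t 0) / φ (γ x t 0) = ρ at *
  generalize deriv (fun s => deriv φ s / φ s) (γ x t 0) = ρ' at *
  generalize thetaR g φ γ x t = Θ at *
  generalize minner (gwR g φ (γ x t)) (meanCurv (gwR g φ) (fun y => γ y t) x) _ = A at *
  generalize meanCurv (gwR g φ) (fun y => γ y t) x 0 = H₀ at *
  clear * - hreact hpos
  rw [ge_iff_le, ← sub_nonneg]
  refine hreact.trans_eq ?_
  field_simp
  ring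

end
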